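/- Let g be the (n+1)-dimensional Lie algebra with basis X, e₁, …, eₙ and brackets [X, eᵢ] = eᵢ. If λ ∉ {0, 1, 2, …, n}, then H*_{λω}(g) = 0 in all degrees, where ω is the closed 1-form dual to X. -/

import Mathlib

set_option linter.unusedSectionVars false

namespace CE

variable (K : Type) [Field K] (L : Type) [LieRing L] [LieAlgebra K L]

/-- A function `(Fin q → L) → K` which is multilinear and alternating:
the underlying predicate of the space of Lie algebra `q`-cochains `Λ^q(𝔤*)`. -/
def IsCochain {q : ℕ} (F : (Fin q → L) → K) : Prop :=
  (∀ (x : Fin q → L) (i : Fin q) (c : K) (u v : L),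
      F (Function.update x i (c • u + v)) =
        c * F (Function.update x i u) + F (Function.update x i v)) ∧
  (∀ (x : Fin q → L) (i j : Fin q), i ≠ j → x i = x j → F x = 0)

/-- The space of `q`-cochains `Λ^q(𝔤*)` as a submodule of all functions. -/
def cochain (q : ℕ) : Submodule K ((Fin q → L) → K) where
  carrier := {F | IsCochain K L F}
  add_mem' := by
    rintro F G ⟨hF1, hF2⟩ ⟨hG1, hG2⟩
    refine ⟨fun x i c u v => ?_, fun x i j hij hx => ?_⟩
    · simp only [Pi.add_apply, hF1, hG1]; ring
    · simp [Pi.add_apply, hF2 x i j hij hx, hG2 x i j hij hx]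
  zero_mem' := ⟨fun x i c u v => by simp, fun x i j h hx => rfl⟩
  smul_mem' := by
    rintro c F ⟨h1, h2⟩
    refine ⟨fun x i a u v => ?_, fun x i j hij hx => ?_⟩
    · simp only [Pi.smul_apply, smul_eq_mul, h1]; ring
    · simp [Pi.smul_apply, h2 x i j hij hx]

variable {K L}

/-- The part of the Chevalley–Eilenberg differential coming from the
(one-dimensional) representation `ρ`:
`Σᵢ (−1)ⁱ ρ(xᵢ) F(x₀,…,x̂ᵢ,…,x_q)`. -/
def term1 (ρ : L →ₗ[K] K) (q : ℕ) (F : (Fin q → L) → K) (x : Fin (q + 1) → L) : K :=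
  ∑ i : Fin (q + 1), (-1 : K) ^ (i : ℕ) * ρ (x i) * F (fun k => x (i.succAbove k))

/-- The part of the Chevalley–Eilenberg differential coming from the Lie bracket;
for alternating multilinear `F` it equals
`Σ_{i<j} (−1)^{i+j} F(⁅xᵢ,xⱼ⁆, x₀, …, x̂ᵢ, …, x̂ⱼ, …, x_q)`, here written by
putting `⁅xᵢ,xⱼ⁆` in the slot of `xⱼ` after deleting `xᵢ`. -/
def term2 (q : ℕ) (F : (Fin q → L) → K) (x : Fin (q + 1) → L) : K :=
  ∑ i : Fin (q + 1), ∑ j : Fin (q + 1),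
    if h : i < j then
      (-1 : K) ^ ((i : ℕ) + 1) *
        F (Function.update (fun k => x (i.succAbove k))
            (j.pred (Fin.ne_zero_of_lt h)) ⁅x i, x j⁆)
    else 0

lemma term1_add (ρ : L →ₗ[K] K) (q : ℕ) (F G : (Fin q → L) → K) (x : Fin (q + 1) → L) :
    term1 ρ q (F + G) x = term1 ρ q F x + term1 ρ q G x := by
  unfold term1
  rw [← Finset.sum_add_distrib]
  exact Finset.sum_congr rfl fun i _ => by simp [mul_add]

lemma term1_smul (ρ : L →ₗ[K] K) (q : ℕ) (c : K) (F : (Fin q → L) → K)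
    (x : Fin (q + 1) → L) : term1 ρ q (c • F) x = c * term1 ρ q F x := by
  unfold term1
  rw [Finset.mul_sum]
  exact Finset.sum_congr rfl fun i _ => by simp; ring

lemma term2_add (q : ℕ) (F G : (Fin q → L) → K) (x : Fin (q + 1) → L) :
    term2 q (F + G) x = term2 q F x + term2 q G x := by
  unfold term2
  rw [← Finset.sum_add_distrib]
  refine Finset.sum_congr rfl fun i _ => ?_
  rw [← Finset.sum_add_distrib]
  refine Finset.sum_congr rfl fun j _ => ?_
  by_cases h : i < j
  · simp [h, mul_add]
  · simp [h]

lemma term2_smul (q : ℕ) (c : K) (F : (Fin q → L) → K) (x : Fin (q + 1) → L) :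
    term2 q (c • F) x = c * term2 q F x := by
  unfold term2
  rw [Finset.mul_sum]
  refine Finset.sum_congr rfl fun i _ => ?_
  rw [Finset.mul_sum]
  refine Finset.sum_congr rfl fun j _ => ?_
  by_cases h : i < j
  · simp [h]; ring
  · simp [h]

variable (K L) in
/-- The Chevalley–Eilenberg differential of the Lie algebra `L` with coefficients in the
one-dimensional representation `ρ : L →ₗ[K] K`, as a linear map on raw functions.
On the alternating multilinear functions (`cochain`) it is the usual differential
`(d f)(x₀,…,x_q) = Σᵢ (−1)ⁱ ρ(xᵢ) f(…,x̂ᵢ,…) + Σ_{i<j} (−1)^{i+j} f(⁅xᵢ,xⱼ⁆,…,x̂ᵢ,…,x̂ⱼ,…)`. -/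
def ceD (ρ : L →ₗ[K] K) (q : ℕ) :
    ((Fin q → L) → K) →ₗ[K] ((Fin (q + 1) → L) → K) where
  toFun F := fun x => term1 ρ q F x + term2 q F x
  map_add' F G := by
    funext x
    simp only [term1_add, term2_add, Pi.add_apply]
    ring
  map_smul' c F := by
    funext x
    simp only [term1_smul, term2_smul, Pi.smul_apply, smul_eq_mul, RingHom.id_apply]
    ring

variable (K L)

/-- Cocycles: alternating multilinear functions killed by the CE differential. -/
def cocycles (ρ : L →ₗ[K] K) (q : ℕ) : Submodule K ((Fin q → L) → K) :=
  cochain K L q ⊓ LinearMap.ker (ceD K L ρ q)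

/-- Coboundaries: images of cochains under the CE differential
(intersected with the cocycles; mathematically the image already consists of cocycles). -/
def coboundaries (ρ : L →ₗ[K] K) : (q : ℕ) → Submodule K ((Fin q → L) → K)
  | 0 => ⊥
  | (q + 1) =>
      (Submodule.map (ceD K L ρ q) (cochain K L q)) ⊓ cocycles K L ρ (q + 1)

/-- The Chevalley–Eilenberg cohomology `H^q(L, K_ρ)` of `L` with coefficients in the
one-dimensional representation `ρ : L →ₗ[K] K` (for `ρ = 0`: trivial coefficients). -/
def cohomology (ρ : L →ₗ[K] K) (q : ℕ) : Type _ :=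
  cocycles K L ρ q ⧸ (coboundaries K L ρ q).comap (cocycles K L ρ q).subtype

instance (ρ : L →ₗ[K] K) (q : ℕ) : AddCommGroup (cohomology K L ρ q) :=
  inferInstanceAs (AddCommGroup (_ ⧸ _))

instance (ρ : L →ₗ[K] K) (q : ℕ) : Module K (cohomology K L ρ q) :=
  inferInstanceAs (Module K (_ ⧸ _))

end CE

/-- The semidirect product `K ⋉ Kⁿ`, where the generator `X = (1, 0)` acts on the abelian
ideal `Kⁿ = Span(e₁,…,eₙ)` as the identity: `⁅X, eᵢ⁆ = eᵢ`. -/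
abbrev Lsd (K : Type) [Field K] (n : ℕ) : Type := K × (Fin n → K)

namespace Lsd

variable (K : Type) [Field K] (n : ℕ)

instance : LieRing (Lsd K n) where
  bracket x y := (0, x.1 • y.2 - y.1 • x.2)
  add_lie x y z := by
    refine Prod.ext (by simp) ?_
    show (x.1 + y.1) • z.2 - z.1 • (x.2 + y.2)
        = (x.1 • z.2 - z.1 • x.2) + (y.1 • z.2 - z.1 • y.2)
    module
  lie_add x y z := by
    refine Prod.ext (by simp) ?_
    show x.1 • (y.2 + z.2) - (y.1 + z.1) • x.2
        = (x.1 • y.2 - y.1 • x.2) + (x.1 • z.2 - z.1 • x.2)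
    module
  lie_self x := by
    refine Prod.ext (by simp) ?_
    show x.1 • x.2 - x.1 • x.2 = 0
    module
  leibniz_lie x y z := by
    refine Prod.ext (by simp) ?_
    show x.1 • (y.1 • z.2 - z.1 • y.2) - (0 : K) • x.2
        = ((0 : K) • z.2 - z.1 • (x.1 • y.2 - y.1 • x.2))
          + (y.1 • (x.1 • z.2 - z.1 • x.2) - (0 : K) • y.2)
    module

instance : LieAlgebra K (Lsd K n) where
  lie_smul t x y := by
    refine Prod.ext (show (0 : K) = t * 0 by simp) ?_
    show x.1 • (t • y.2) - (t * y.1) • x.2 = t • (x.1 • y.2 - y.1 • x.2)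
    rw [mul_comm]
    module

end Lsd

namespace CE

variable {K : Type} [Field K] {L : Type} [LieRing L] [LieAlgebra K L] {q : ℕ}

/-- A cochain, bundled as an alternating map. -/
def IsCochain.toAlternatingMap {F : (Fin q → L) → K} (hF : IsCochain K L F) :
    L [⋀^Fin q]→ₗ[K] K where
  toFun := F
  map_update_add' {inst} x i u v := by
    obtain rfl := Subsingleton.elim inst (instDecidableEqFin q)
    simpa using hF.1 x i 1 u v
  map_update_smul' {inst} x i c u := by
    obtain rfl := Subsingleton.elim inst (instDecidableEqFin q)
    have h0 : F (Function.update x i 0) = 0 := by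
      simpa using hF.1 x i 1 0 0
    simpa [h0] using hF.1 x i c u 0
  map_eq_zero_of_eq' x i j h hij := hF.2 x i j hij h

lemma isCochain_coe (f : L [⋀^Fin q]→ₗ[K] K) : IsCochain K L f :=
  ⟨fun x i c u v => by simp, fun x _ _ hij h => f.map_eq_zero_of_eq x h hij⟩

end CE

namespace Lsd

variable {K : Type} [Field K] {n q : ℕ}

lemma lie_eq (x y : Lsd K n) : ⁅x, y⁆ = x.1 • y - y.1 • x := by
  refine Prod.ext ?_ rfl
  change (0 : K) = x.1 * y.1 - y.1 * x.1
  ring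

/-- The exterior product `ω ∧ f`, where `ω` is the 1-form dual to `X`. -/
def wedge (f : Lsd K n [⋀^Fin q]→ₗ[K] K) : Lsd K n [⋀^Fin (q + 1)]→ₗ[K] K :=
  AlternatingMap.alternatizeUncurryFin ((LinearMap.fst K K (Fin n → K)).smulRight f)

lemma wedge_apply (f : Lsd K n [⋀^Fin q]→ₗ[K] K) (x : Fin (q + 1) → Lsd K n) :
    wedge f x = ∑ i : Fin (q + 1), (-1) ^ (i : ℕ) * (x i).1 * f (i.removeNth x) := by
  simp [wedge, AlternatingMap.alternatizeUncurryFin_apply, mul_assoc]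

lemma eq_zero_of_lt (h : n + 1 < q) (f : Lsd K n [⋀^Fin q]→ₗ[K] K) : f = 0 := by
  ext x
  refine f.map_linearDependent x fun hx => ?_
  have := hx.fintype_card_le_finrank
  simp at this
  omega

lemma removeNth_update_of_lt {α : Type*} (x : Fin (q + 1) → α) {i j : Fin (q + 1)} (h : i < j)
    (a : α) : i.removeNth (Function.update x j a) =
      Function.update (fun k => x (i.succAbove k)) (j.pred (Fin.ne_zero_of_lt h)) a := by
  conv_lhs => rw [← Fin.succAbove_pred_of_lt i j h]
  exact Fin.removeNth_update_succAbove ..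

/-- Deleting `x i` and putting it in the slot of `x j` amounts to a signed deletion of `x j`. -/
lemma map_update_pred (f : Lsd K n [⋀^Fin q]→ₗ[K] K) (x : Fin (q + 1) → Lsd K n)
    {i j : Fin (q + 1)} (h : i < j) :
    (-1) ^ (i : ℕ) * f (Function.update (fun k => x (i.succAbove k))
      (j.pred (Fin.ne_zero_of_lt h)) (x i)) = -((-1) ^ (j : ℕ) * f (j.removeNth x)) := by
  have := f.neg_one_pow_smul_map_removeNth_add_eq_zero_of_eq
    (v := Function.update x j (x i)) (i := i) (j := j) (by simp [h.ne]) h.ne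
  rw [removeNth_update_of_lt x h, Fin.removeNth_update] at this
  simpa using eq_neg_of_add_eq_zero_left this

lemma term2_eq (f : Lsd K n [⋀^Fin q]→ₗ[K] K) (x : Fin (q + 1) → Lsd K n) :
    CE.term2 q f x = -(q * wedge f x) := by
  set a : Fin (q + 1) → K := fun i => (-1) ^ (i : ℕ) * (x i).1 * f (i.removeNth x) with ha
  have hterm (i j : Fin (q + 1)) :
      (if h : i < j then (-1 : K) ^ ((i : ℕ) + 1) *
        f (Function.update (fun k => x (i.succAbove k))
            (j.pred (Fin.ne_zero_of_lt h)) ⁅x i, x j⁆) else 0) =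
      (if i < j then -a i else 0) + (if i < j then -a j else 0) := by
    split_ifs with h
    · have hj : Function.update (fun k => x (i.succAbove k))
          (j.pred (Fin.ne_zero_of_lt h)) (x j) = i.removeNth x := by
        rw [← removeNth_update_of_lt x h, Function.update_eq_self]
      rw [lie_eq, f.map_update_sub, f.map_update_smul, f.map_update_smul, hj]
      simp only [ha, smul_eq_mul]
      linear_combination (x j).1 * map_update_pred f x h
    · simp
  unfold CE.term2
  simp_rw [hterm, Finset.sum_add_distrib]
  rw [Finset.sum_comm (f := fun i j => if i < j then -a j else 0), ← Finset.sum_add_distrib,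
    wedge_apply, Finset.mul_sum, ← Finset.sum_neg_distrib]
  refine Finset.sum_congr rfl fun i _ => ?_
  simp only [← Finset.sum_filter, Finset.sum_const, Finset.filter_lt_eq_Ioi,
    Finset.filter_gt_eq_Iio, Fin.card_Ioi, Fin.card_Iio, ← add_smul]
  rw [show q + 1 - 1 - (i : ℕ) + i = q by omega, nsmul_eq_mul, mul_neg]

/-- The differential twisted by `l • ω` acts on `q`-cochains as `(l - q) • (ω ∧ ·)`. -/
lemma ceD_eq (l : K) (f : Lsd K n [⋀^Fin q]→ₗ[K] K) :
    CE.ceD K (Lsd K n) (l • LinearMap.fst K K (Fin n → K)) q f = (l - q) • ⇑(wedge f) := by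
  funext x
  change CE.term1 _ q f x + CE.term2 q f x = (l - q) * wedge f x
  have h1 : CE.term1 (l • LinearMap.fst K K (Fin n → K)) q f x = l * wedge f x := by
    rw [wedge_apply, Finset.mul_sum]
    refine Finset.sum_congr rfl fun i _ => ?_
    change _ * (l * (x i).1) * f (i.removeNth x) = _
    ring
  rw [h1, term2_eq]
  ring

lemma wedge_eq_zero_of_ceD_eq_zero {l : K} (hl : ∀ m : ℕ, m ≤ n → l ≠ (m : K))
    {f : Lsd K n [⋀^Fin q]→ₗ[K] K}
    (hf : CE.ceD K (Lsd K n) (l • LinearMap.fst K K (Fin n → K)) q f = 0) : wedge f = 0 := by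
  rcases le_or_gt q n with h | h
  · rw [ceD_eq, smul_eq_zero_iff_right (sub_ne_zero.2 (hl q h))] at hf
    exact DFunLike.coe_injective hf
  · exact eq_zero_of_lt (by omega) _

/-- Contracting `ω ∧ f` with `X` gives `f - ω ∧ (ι_X f)`. -/
lemma wedge_vecCons (f : Lsd K n [⋀^Fin (q + 1)]→ₗ[K] K) (x : Fin (q + 1) → Lsd K n) :
    wedge f (Matrix.vecCons (1, 0) x) = f x - wedge (f.curryLeft (1, 0)) x := by
  rw [wedge_apply, wedge_apply, Fin.sum_univ_succ, sub_eq_add_neg, ← Finset.sum_neg_distrib]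
  congr 1
  · simp [Matrix.vecCons]
  · refine Finset.sum_congr rfl fun i _ => ?_
    have : i.succ.removeNth (Matrix.vecCons ((1, 0) : Lsd K n) x) =
        Matrix.vecCons (1, 0) (i.removeNth x) := by
      funext k
      refine Fin.cases ?_ (fun k => ?_) k <;> simp [Fin.removeNth]
    rw [this, AlternatingMap.curryLeft_apply_apply]
    simp [pow_succ]

lemma wedge_curryLeft {f : Lsd K n [⋀^Fin (q + 1)]→ₗ[K] K} (hf : wedge f = 0) :
    wedge (f.curryLeft (1, 0)) = f := by
  ext x
  have := wedge_vecCons f x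
  rw [hf, AlternatingMap.zero_apply] at this
  exact (sub_eq_zero.1 this.symm).symm

lemma eq_zero_of_wedge_eq_zero {f : Lsd K n [⋀^Fin 0]→ₗ[K] K} (hf : wedge f = 0) : f = 0 := by
  ext x
  have := wedge_apply f (fun _ => (1, 0))
  rw [hf, Fin.sum_univ_one, Subsingleton.elim (Fin.removeNth _ _) x] at this
  simpa using this.symm

lemma cocycles_le_coboundaries {l : K} (hl : ∀ m : ℕ, m ≤ n → l ≠ (m : K)) (q : ℕ) :
    CE.cocycles K (Lsd K n) (l • LinearMap.fst K K (Fin n → K)) q ≤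
      CE.coboundaries K (Lsd K n) (l • LinearMap.fst K K (Fin n → K)) q := by
  rintro F hF
  obtain ⟨f, rfl⟩ : ∃ f : Lsd K n [⋀^Fin q]→ₗ[K] K, ⇑f = F :=
    ⟨CE.IsCochain.toAlternatingMap hF.1, rfl⟩
  have hw : wedge f = 0 := wedge_eq_zero_of_ceD_eq_zero hl hF.2
  cases q with
  | zero =>
    rw [eq_zero_of_wedge_eq_zero hw]
    exact Submodule.zero_mem _
  | succ q =>
    refine ⟨?_, hF⟩
    rcases le_or_gt q n with h | h
    · refine ⟨(l - q : K)⁻¹ • ⇑(f.curryLeft (1, 0)),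
        Submodule.smul_mem _ _ (CE.isCochain_coe _), ?_⟩
      rw [map_smul, ceD_eq, wedge_curryLeft hw,
        inv_smul_smul₀ (sub_ne_zero.2 (hl q h))]
    · rw [eq_zero_of_lt (by omega) f]
      exact Submodule.zero_mem _

end Lsd

/-- Let `g` be the `(n+1)`-dimensional Lie algebra with basis
`X, e₁, …, eₙ` and brackets `⁅X, eᵢ⁆ = eᵢ`, and let `ω` be the closed 1-form dual to `X`.
If `λ ∉ {0, 1, 2, …, n}` then `H*_{λω}(g) = 0` in all degrees. -/
theorem stmt16 (K : Type) [Field K] [CharZero K] (n : ℕ) (l : K)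
    (hl : ∀ m : ℕ, m ≤ n → l ≠ (m : K)) :
    ∀ q : ℕ,
      Subsingleton (CE.cohomology K (Lsd K n) (l • LinearMap.fst K K (Fin n → K)) q) := by
  intro q
  exact Submodule.Quotient.subsingleton_iff.2 <|
    Submodule.comap_subtype_eq_top.2 (Lsd.cocycles_le_coboundaries hl q)
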